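/- There is no constant k ∈ ℕ such that every finite maximal class of VC dimension d can be embedded into a maximum class of VC dimension d + k: for every k ∈ ℕ there exist d, n and a maximal class C ⊆ {0,1}^n of VC dimension d such that no maximum class C' ⊆ {0,1}^n with C ⊆ C' has VC dimension at most d + k. -/

import Mathlib

open Finset

namespace GeomCompress

/-- `C` shatters the coordinate set `Y`: every pattern on `Y` is realized by some concept. -/
def Shatters {n : ℕ} (C : Finset (Fin n → Bool)) (Y : Finset (Fin n)) : Prop :=
  ∀ p : Fin n → Bool, ∃ c ∈ C, ∀ i ∈ Y, c i = p i

/-- The VC dimension of `C` equals `d`. -/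
def VCDimEq {n : ℕ} (C : Finset (Fin n → Bool)) (d : ℕ) : Prop :=
  (∃ Y : Finset (Fin n), Y.card = d ∧ Shatters C Y) ∧
    ∀ Y : Finset (Fin n), Shatters C Y → Y.card ≤ d

/-- `C` is a `d`-maximum class: VC dimension `d` and maximum possible cardinality. -/
def IsMaximum {n : ℕ} (C : Finset (Fin n → Bool)) (d : ℕ) : Prop :=
  VCDimEq C d ∧ C.card = ∑ i ∈ Finset.range (d + 1), Nat.choose n i

/-- Hamming distance between two Boolean vectors. -/
def hamming {n : ℕ} (u v : Fin n → Bool) : ℕ :=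
  (Finset.univ.filter fun i => u i ≠ v i).card

/-- Adjacency in the one-inclusion graph: differ in exactly one coordinate. -/
def Adj {n : ℕ} (u v : Fin n → Bool) : Prop := hamming u v = 1

instance {n : ℕ} (u v : Fin n → Bool) : Decidable (Adj u v) := by
  unfold Adj; infer_instance

/-- `Q` is a cube of `C` colored by `I`: a subset of `C` whose elements agree outside `I`
and realize all patterns on `I`. -/
def IsCube {n : ℕ} (C Q : Finset (Fin n → Bool)) (I : Finset (Fin n)) : Prop :=
  Q ⊆ C ∧ (∀ u ∈ Q, ∀ v ∈ Q, ∀ i, i ∉ I → u i = v i) ∧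
    ∀ p : Fin n → Bool, ∃ u ∈ Q, ∀ i ∈ I, u i = p i

/-- `v` is a corner vertex of `C`: there is a unique cube of maximum dimension among all
cubes of `C` containing `v`, and all neighbors of `v` in the one-inclusion graph of `C`
lie in that cube. -/
def IsCorner {n : ℕ} (C : Finset (Fin n → Bool)) (v : Fin n → Bool) : Prop :=
  ∃ Q I, IsCube C Q I ∧ v ∈ Q ∧
    (∀ Q' I', IsCube C Q' I' → v ∈ Q' → I'.card ≤ I.card) ∧
    (∀ Q' I', IsCube C Q' I' → v ∈ Q' → I'.card = I.card → Q' = Q) ∧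
    ∀ u ∈ C, Adj u v → u ∈ Q

/-- The class remaining after peeling the first `t` vertices of the ordering `v`. -/
def Peeled {n m : ℕ} (C : Finset (Fin n → Bool)) (v : Fin m → (Fin n → Bool)) (t : Fin m) :
    Finset (Fin n → Bool) :=
  C \ (Finset.univ.filter fun s : Fin m => s < t).image v

/-- `v` is a corner-peeling ordering of `C`: an enumeration of `C` such that each `v t`
is a corner vertex of the class remaining before step `t`. -/
def IsCornerPeeling {n : ℕ} (C : Finset (Fin n → Bool)) (v : Fin C.card → (Fin n → Bool)) :
    Prop :=
  Function.Injective v ∧ (∀ t, v t ∈ C) ∧ ∀ t, IsCorner (Peeled C v t) (v t)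

/-- Degree of `v` in the one-inclusion graph of `C`. -/
def degreeIn {n : ℕ} (C : Finset (Fin n → Bool)) (v : Fin n → Bool) : ℕ :=
  (C.filter fun u => Adj u v).card

/-- The colors of the edges incident to `v` in the one-inclusion graph of `C`. -/
def incidentColors {n : ℕ} (C : Finset (Fin n → Bool)) (v : Fin n → Bool) : Finset (Fin n) :=
  Finset.univ.filter fun i => ∃ u ∈ C, Adj u v ∧ u i ≠ v i

/-- `C` is shortest-path closed: any two concepts are joined in the one-inclusion graph of
`C` by a path whose length is their Hamming distance. -/
def SPClosed {n : ℕ} (C : Finset (Fin n → Bool)) : Prop :=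
  ∀ u ∈ C, ∀ v ∈ C, ∃ p : ℕ → (Fin n → Bool),
    p 0 = u ∧ p (hamming u v) = v ∧ (∀ k ≤ hamming u v, p k ∈ C) ∧
    ∀ k < hamming u v, Adj (p k) (p (k + 1))

/-- `Q` (colored by `I`, with `I.card = d - 1`) is a cube of the boundary `∂C` of the
`d`-maximum class `C`: it is a face of exactly one `d`-cube of `C`. -/
def IsBoundaryCube {n : ℕ} (C : Finset (Fin n → Bool)) (d : ℕ)
    (Q : Finset (Fin n → Bool)) (I : Finset (Fin n)) : Prop :=
  IsCube C Q I ∧ I.card = d - 1 ∧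
    (∃ Q' I', IsCube C Q' I' ∧ I'.card = d ∧ Q ⊆ Q' ∧ I ⊆ I') ∧
    ∀ Q₁ I₁ Q₂ I₂, IsCube C Q₁ I₁ → I₁.card = d → Q ⊆ Q₁ → I ⊆ I₁ →
      IsCube C Q₂ I₂ → I₂.card = d → Q ⊆ Q₂ → I ⊆ I₂ → Q₁ = Q₂

/-- Standard inner product on `Fin d → ℝ`. -/
def dotR {d : ℕ} (x y : Fin d → ℝ) : ℝ := ∑ i, x i * y i

/-- `x` lies on none of the hyperplanes `⟪a i, ·⟫ = b i`. -/
def OnNoHyperplane {d N : ℕ} (a : Fin N → Fin d → ℝ) (b : Fin N → ℝ) (x : Fin d → ℝ) :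
    Prop :=
  ∀ i, dotR (a i) x ≠ b i

/-- The sign vector of the point `x` with respect to the oriented hyperplanes `(a, b)`. -/
noncomputable def signVec {d N : ℕ} (a : Fin N → Fin d → ℝ) (b : Fin N → ℝ)
    (x : Fin d → ℝ) : Fin N → Bool :=
  fun i => decide (b i < dotR (a i) x)

/-- `C` is the concept class induced by the arrangement `(a, b)`: the set of sign vectors
of points lying on none of the hyperplanes. -/
def IsInducedClass {d N : ℕ} (a : Fin N → Fin d → ℝ) (b : Fin N → ℝ)
    (C : Finset (Fin N → Bool)) : Prop :=
  ∀ c, c ∈ C ↔ ∃ x : Fin d → ℝ, OnNoHyperplane a b x ∧ signVec a b x = c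

/-- A simple linear arrangement in `ℝ^d`: every `≤ d` of the hyperplanes are in general
position (normals linearly independent, so every `k ≤ d` of them intersect in an affine
subspace of dimension `d - k`), and every `d+1` of them have empty common intersection. -/
def SimpleArrangement (d : ℕ) {N : ℕ} (a : Fin N → Fin d → ℝ) (b : Fin N → ℝ) : Prop :=
  (∀ S : Finset (Fin N), S.card ≤ d → LinearIndependent ℝ (fun i : S => a i.1)) ∧
    ∀ S : Finset (Fin N), S.card = d + 1 → ¬∃ x : Fin d → ℝ, ∀ i ∈ S, dotR (a i) x = b i

/-- Membership in the open unit ball (Klein model of hyperbolic space `H^k`). -/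
def inBall {k : ℕ} (x : Fin k → ℝ) : Prop := ∑ i, x i ^ 2 < 1

/-- A simple hyperbolic `d`-arrangement in the Klein model `H^k`: every `d` of the
hyperplanes intersect inside the unit ball in a `(k-d)`-dimensional hyperbolic plane
(normals independent and common point inside the ball), and every `d+1` of them have
empty common intersection inside the ball. -/
def SimpleHyperbolicArrangement (d : ℕ) {k N : ℕ} (a : Fin N → Fin k → ℝ)
    (b : Fin N → ℝ) : Prop :=
  (∀ S : Finset (Fin N), S.card = d →
      LinearIndependent ℝ (fun i : S => a i.1) ∧
        ∃ x : Fin k → ℝ, inBall x ∧ ∀ i ∈ S, dotR (a i) x = b i) ∧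
    ∀ S : Finset (Fin N), S.card = d + 1 →
      ¬∃ x : Fin k → ℝ, inBall x ∧ ∀ i ∈ S, dotR (a i) x = b i

/-- The concept class induced by a hyperbolic arrangement: sign vectors of points of the
open unit ball lying on none of the hyperplanes. -/
def IsInducedClassH {k N : ℕ} (a : Fin N → Fin k → ℝ) (b : Fin N → ℝ)
    (C : Finset (Fin N → Bool)) : Prop :=
  ∀ c, c ∈ C ↔ ∃ x : Fin k → ℝ, inBall x ∧ OnNoHyperplane a b x ∧ signVec a b x = c

/-- A generic arrangement of oriented affine hyperplanes in `ℝ^n`: every subcollection of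
`k` hyperplanes, `2 ≤ k ≤ n`, either has empty common intersection or intersects
transversely (normals linearly independent, giving an affine subspace of dim `n - k`). -/
def GenericArrangement {n N : ℕ} (a : Fin N → Fin n → ℝ) (b : Fin N → ℝ) : Prop :=
  ∀ S : Finset (Fin N), 2 ≤ S.card → S.card ≤ n →
    (¬∃ x : Fin n → ℝ, ∀ i ∈ S, dotR (a i) x = b i) ∨
      LinearIndependent ℝ (fun i : S => a i.1)

/-- `C` is a maximal class of VC dimension `d`: adding any new concept increases the VC
dimension. -/
def IsMaximalClass {n : ℕ} (C : Finset (Fin n → Bool)) (d : ℕ) : Prop :=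
  VCDimEq C d ∧
    ∀ c : Fin n → Bool, c ∉ C →
      ∃ Y : Finset (Fin n), d < Y.card ∧ Shatters (insert c C) Y

/-- A path in the one-inclusion graph of `C` avoiding `C'`, from a vertex of `Q1` to a
vertex of `Q2`. -/
def CConnPath {n : ℕ} (C C' Q1 Q2 : Finset (Fin n → Bool)) : Prop :=
  ∃ (L : ℕ) (p : ℕ → Fin n → Bool),
    p 0 ∈ Q1 ∧ p L ∈ Q2 ∧ (∀ j ≤ L, p j ∈ C ∧ p j ∉ C') ∧
      ∀ j < L, Adj (p j) (p (j + 1))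

/-- `Q1` and `Q2` are `d`-cubes of `C` joined by a path of the one-inclusion graph of `C`
avoiding `C'`. -/
def CComponentRel {n : ℕ} (C C' : Finset (Fin n → Bool)) (d : ℕ)
    (Q1 Q2 : Finset (Fin n → Bool)) : Prop :=
  (∃ I, IsCube C Q1 I ∧ I.card = d) ∧ (∃ I, IsCube C Q2 I ∧ I.card = d) ∧
    CConnPath C C' Q1 Q2

/-- `Comp` enumerates the `C'`-connected components of `C`: each component is a union of
`d`-cubes of `C`, every `d`-cube lies in exactly one component, and two `d`-cubes lie in
the same component iff they are related under the transitive closure of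
`C'`-connectedness. -/
def IsComponents {n : ℕ} (C C' : Finset (Fin n → Bool)) (d : ℕ) {k : ℕ}
    (Comp : Fin k → Finset (Fin n → Bool)) : Prop :=
  (∀ q, ∀ x ∈ Comp q, ∃ Q I, IsCube C Q I ∧ I.card = d ∧ x ∈ Q ∧ Q ⊆ Comp q) ∧
  (∀ Q I, IsCube C Q I → I.card = d → ∃ q, Q ⊆ Comp q) ∧
  (∀ q q' Q I, IsCube C Q I → I.card = d → Q ⊆ Comp q → Q ⊆ Comp q' → q = q') ∧
  ∀ q Q1 I1, IsCube C Q1 I1 → I1.card = d → Q1 ⊆ Comp q →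
    ∀ Q2 I2, IsCube C Q2 I2 → I2.card = d →
      (Q2 ⊆ Comp q ↔ Relation.TransGen (CComponentRel C C' d) Q1 Q2)

/-- Append the bit `b` as a new last coordinate. -/
def app {n : ℕ} (c : Fin n → Bool) (b : Bool) : Fin (n + 1) → Bool := Fin.snoc c b

/-- The lift `(C' × {0,1}) ∪ ⋃_q (Comp q × {p q})`. -/
def LiftClass {n k : ℕ} (C' : Finset (Fin n → Bool))
    (Comp : Fin k → Finset (Fin n → Bool)) (p : Fin k → Bool) :
    Finset (Fin (n + 1) → Bool) :=
  C'.image (fun c => app c false) ∪ C'.image (fun c => app c true) ∪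
    Finset.univ.biUnion fun q => (Comp q).image fun c => app c (p q)

section Shattering

variable {n : ℕ}

open Classical in
/-- The sets of coordinates shattered by `C`. -/
noncomputable def shatteredSets (C : Finset (Fin n → Bool)) : Finset (Finset (Fin n)) :=
  univ.filter fun Y => Shatters C Y

lemma mem_shatteredSets {C : Finset (Fin n → Bool)} {Y : Finset (Fin n)} :
    Y ∈ shatteredSets C ↔ Shatters C Y := by
  simp [shatteredSets]

lemma Shatters.mono {C C' : Finset (Fin n → Bool)} (h : C ⊆ C') {Y : Finset (Fin n)}
    (hY : Shatters C Y) : Shatters C' Y := fun p =>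
  let ⟨c, hc, hcp⟩ := hY p
  ⟨c, h hc, hcp⟩

/-- Pajor's inequality: a class has at most as many concepts as shattered sets. -/
lemma card_le_card_shatteredSets (C : Finset (Fin n → Bool)) :
    C.card ≤ (shatteredSets C).card := by
  classical
  let f : (Fin n → Bool) → Finset (Fin n) := fun c => univ.filter fun i => c i = true
  have hf : Function.Injective f := by
    intro a b hab
    funext i
    have h : i ∈ f a ↔ i ∈ f b := by rw [hab]
    simp only [f, mem_filter, mem_univ, true_and] at h
    exact Bool.eq_iff_iff.2 h
  calc C.card = (C.image f).card := (card_image_of_injective C hf).symm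
    _ ≤ (C.image f).shatterer.card := card_le_card_shatterer _
    _ ≤ (shatteredSets C).card := by
      refine card_le_card fun Y hY => ?_
      rw [Finset.mem_shatterer] at hY
      rw [mem_shatteredSets]
      intro p
      obtain ⟨u, hu, hYU⟩ := hY (t := Y.filter fun i => p i = true) (filter_subset _ _)
      obtain ⟨c, hc, rfl⟩ := mem_image.1 hu
      refine ⟨c, hc, fun i hi => ?_⟩
      have h : i ∈ Y ∩ f c ↔ i ∈ Y.filter fun i => p i = true := by rw [hYU]
      simp only [f, mem_inter, mem_filter, mem_univ, true_and, hi] at h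
      exact Bool.eq_iff_iff.2 h

lemma IsMaximum.card_shatteredSets_le {C : Finset (Fin n → Bool)} {D : ℕ}
    (h : IsMaximum C D) : (shatteredSets C).card ≤ C.card := by
  rw [h.2]
  have hmaps : ∀ Y ∈ shatteredSets C, Y.card ∈ range (D + 1) := fun Y hY =>
    mem_range.2 (Nat.lt_succ_of_le (h.1.2 Y (mem_shatteredSets.1 hY)))
  rw [card_eq_sum_card_fiberwise hmaps]
  refine sum_le_sum fun i _ => ?_
  calc _ ≤ (powersetCard i (univ : Finset (Fin n))).card := by
        refine card_le_card fun Y hY => ?_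
        simpa [mem_powersetCard] using (mem_filter.1 hY).2
    _ = n.choose i := by simp

/-- A labelling that is constant along the edges of the complement of `C` is constant on every
cube contained in that complement. -/
lemma label_eq_of_cube {C : Finset (Fin n → Bool)} {α : Type*} (q : (Fin n → Bool) → α)
    (hq : ∀ x i b, x ∉ C → Function.update x i b ∉ C → q (Function.update x i b) = q x)
    {Y : Finset (Fin n)} {p : Fin n → Bool} (hp : ∀ c, (∀ i ∈ Y, c i = p i) → c ∉ C)
    {c : Fin n → Bool} (hc : ∀ i ∈ Y, c i = p i) : q c = q p := by
  classical
  have key : ∀ T : Finset (Fin n), q (T.piecewise c p) = q p := by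
    intro T
    have hmem : ∀ T : Finset (Fin n), T.piecewise c p ∉ C := by
      intro T
      refine hp _ fun i hi => ?_
      by_cases h : i ∈ T <;> simp [h, hc i hi]
    induction T using Finset.induction_on with
    | empty => simp
    | insert a T _ ih =>
      have h := hmem (insert a T)
      rw [piecewise_insert] at h ⊢
      rw [hq _ _ _ (hmem T) h, ih]
  simpa using key univ

/-- The complement of a maximum class is connected: labellings constant along its edges are
constant. -/
lemma IsMaximum.label_eq_of_notMem {C : Finset (Fin n → Bool)} {D : ℕ} (hC : IsMaximum C D)
    {α : Type*} (q : (Fin n → Bool) → α)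
    (hq : ∀ x i b, x ∉ C → Function.update x i b ∉ C → q (Function.update x i b) = q x)
    {u v : Fin n → Bool} (hu : u ∉ C) (hv : v ∉ C) : q v = q u := by
  classical
  by_contra hne
  let C₁ : Finset (Fin n → Bool) := univ.filter fun x => x ∈ C ∨ q x = q u
  let C₂ : Finset (Fin n → Bool) := univ.filter fun x => x ∈ C ∨ q x ≠ q u
  have hunion : C₁ ∪ C₂ = univ := by
    ext x; simp only [C₁, C₂, mem_union, mem_filter, mem_univ, true_and, iff_true]; tauto
  have hinter : C₁ ∩ C₂ = C := by
    ext x; simp only [C₁, C₂, mem_inter, mem_filter, mem_univ, true_and]; tauto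
  have hsub : shatteredSets C₁ ∩ shatteredSets C₂ ⊆ shatteredSets C := by
    intro Y hY
    rw [mem_inter, mem_shatteredSets, mem_shatteredSets] at hY
    rw [mem_shatteredSets]
    by_contra hnot
    unfold Shatters at hnot
    push Not at hnot
    obtain ⟨p, hp⟩ := hnot
    have hp' : ∀ c, (∀ i ∈ Y, c i = p i) → c ∉ C := by
      intro c hc hcC
      obtain ⟨i, hi, hne⟩ := hp c hcC
      exact hne (hc i hi)
    obtain ⟨c₁, hc₁, h₁⟩ := hY.1 p
    obtain ⟨c₂, hc₂, h₂⟩ := hY.2 p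
    have e₁ := label_eq_of_cube q hq hp' h₁
    have e₂ := label_eq_of_cube q hq hp' h₂
    simp only [C₁, C₂, mem_filter, mem_univ, true_and] at hc₁ hc₂
    exact hc₂.resolve_left (hp' _ h₂) (e₂.trans (e₁.symm.trans (hc₁.resolve_left (hp' _ h₁))))
  have huniv : (univ : Finset (Fin n)) ∉ shatteredSets C₁ ∪ shatteredSets C₂ := by
    rw [mem_union, mem_shatteredSets, mem_shatteredSets]
    rintro (h | h)
    · obtain ⟨c, hc, hcv⟩ := h v
      obtain rfl : c = v := funext fun i => hcv i (mem_univ i)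
      simp [C₁, hv, hne] at hc
    · obtain ⟨c, hc, hcu⟩ := h u
      obtain rfl : c = u := funext fun i => hcu i (mem_univ i)
      simp [C₂, hu] at hc
  have hlt : (shatteredSets C₁ ∪ shatteredSets C₂).card < 2 ^ n := by
    have := card_lt_univ_of_notMem huniv
    simpa using this
  have hcard : C₁.card + C₂.card = 2 ^ n + C.card := by
    rw [← card_union_add_card_inter, hunion, hinter]
    simp
  have hsh := card_union_add_card_inter (shatteredSets C₁) (shatteredSets C₂)
  have h₁ := card_le_card_shatteredSets C₁
  have h₂ := card_le_card_shatteredSets C₂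
  have h₃ := card_le_card hsub
  have h₄ := hC.card_shatteredSets_le
  omega

/-- If the complement of `C` is labelled by coordinates so that labels are constant along edges
and each concept vanishes at its label, then no maximum class of dimension at most `n - 2`
contains `C`. -/
lemma IsMaximum.le_of_label {C C' : Finset (Fin n → Bool)} {D : ℕ} (hC : IsMaximum C' D)
    (hsub : C ⊆ C') (q : (Fin n → Bool) → ℕ)
    (hq : ∀ x i b, x ∉ C → Function.update x i b ∉ C → q (Function.update x i b) = q x)
    (hfalse : ∀ x, x ∉ C → ∃ i : Fin n, (i : ℕ) = q x ∧ x i = false) : n ≤ D + 1 := by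
  classical
  by_contra! hlt
  have hnot : ∀ Y : Finset (Fin n), D < Y.card →
      ∃ p : Fin n → Bool, ∀ c, (∀ i ∈ Y, c i = p i) → c ∉ C' := by
    intro Y hY
    by_contra! h
    have := hC.1.2 Y fun p => let ⟨c, hc, hcC⟩ := h p; ⟨c, hcC, hc⟩
    omega
  obtain ⟨u, hu⟩ := hnot univ (by simp; omega)
  have hu := hu u fun _ _ => rfl
  obtain ⟨i, hi, -⟩ := hfalse u fun h => hu (hsub h)
  obtain ⟨p, hp⟩ := hnot (univ.erase i) (by simp; omega)
  have hv : Function.update p i true ∉ C' := hp _ fun j hj => by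
    rw [Function.update_of_ne (ne_of_mem_erase hj)]
  obtain ⟨j, hj, hjf⟩ := hfalse _ fun h => hv (hsub h)
  have heq := hC.label_eq_of_notMem q
    (fun x i b hx hy => hq x i b (fun h => hx (hsub h)) fun h => hy (hsub h)) hu hv
  obtain rfl : j = i := Fin.ext (by rw [hj, heq, hi])
  simp at hjf

/-- Every nonempty class extends to a maximal class of the same VC dimension. -/
lemma exists_isMaximalClass_superset {C : Finset (Fin n → Bool)} (hC : C.Nonempty) :
    ∃ d M, C ⊆ M ∧ IsMaximalClass M d ∧ VCDimEq C d := by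
  classical
  obtain ⟨Y, hY, hmax⟩ := exists_max_image (shatteredSets C) card
    ⟨∅, mem_shatteredSets.2 fun _ => hC.imp fun c hc => ⟨hc, by simp⟩⟩
  have hY := mem_shatteredSets.1 hY
  have hmax : ∀ Z, Shatters C Z → Z.card ≤ Y.card := fun Z hZ =>
    hmax Z (mem_shatteredSets.2 hZ)
  obtain ⟨M, hM, hMmax⟩ := exists_max_image
    (univ.filter fun M : Finset (Fin n → Bool) =>
      C ⊆ M ∧ ∀ Z, Shatters M Z → Z.card ≤ Y.card) card ⟨C, by simpa using hmax⟩
  simp only [mem_filter, mem_univ, true_and] at hM hMmax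
  refine ⟨Y.card, M, hM.1, ⟨⟨⟨Y, rfl, hY.mono hM.1⟩, hM.2⟩, fun c hc => ?_⟩,
    ⟨Y, rfl, hY⟩, hmax⟩
  by_contra! h
  have := hMmax (insert c M) ⟨hM.1.trans (subset_insert _ _), fun Z hZ =>
    not_lt.1 fun hlt => h Z hlt hZ⟩
  rw [card_insert_of_notMem hc] at this
  omega

end Shattering

section Layers

variable {n : ℕ}

/-- The number of coordinates at which `x` is true. -/
def weight (x : Fin n → Bool) : ℕ := (univ.filter fun i => x i = true).card

lemma weight_update_true {x : Fin n → Bool} {i : Fin n} (hx : x i = false) :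
    weight (Function.update x i true) = weight x + 1 := by
  classical
  unfold weight
  rw [← card_insert_of_notMem (s := univ.filter fun j => x j = true) (a := i) (by simp [hx])]
  congr 1
  ext j
  by_cases h : j = i
  · subst h; simp
  · simp [h]

/-- The concepts `x` for which the weight has the form `i * (m + 2) + r` with `r ≤ m` and
`x i = false`. -/
def layerClass (n m : ℕ) : Finset (Fin n → Bool) :=
  univ.filter fun x => weight x % (m + 2) ≠ m + 1 ∧
    ∃ i : Fin n, (i : ℕ) = weight x / (m + 2) ∧ x i = false

lemma mem_layerClass {m : ℕ} {x : Fin n → Bool} :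
    x ∈ layerClass n m ↔ weight x % (m + 2) ≠ m + 1 ∧
      ∃ i : Fin n, (i : ℕ) = weight x / (m + 2) ∧ x i = false := by
  simp [layerClass]

lemma succ_div_eq_of_mod_ne {w m : ℕ} (h : w % (m + 2) ≠ m + 1) :
    (w + 1) / (m + 2) = w / (m + 2) := by
  rw [Nat.succ_div, if_neg, add_zero]
  intro hd
  have h₁ := Nat.mod_lt w (show 0 < m + 2 by omega)
  have h₂ : (w % (m + 2) + 1) % (m + 2) = 0 := by
    rw [Nat.mod_add_mod]; exact Nat.mod_eq_zero_of_dvd hd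
  rw [Nat.mod_eq_of_lt (by omega)] at h₂
  omega

lemma weight_div_update {m : ℕ} {x : Fin n → Bool} {i : Fin n} {b : Bool}
    (hx : x ∈ layerClass n m) (hy : Function.update x i b ∈ layerClass n m) :
    weight (Function.update x i b) / (m + 2) = weight x / (m + 2) := by
  by_cases h : b = x i
  · subst h; simp
  · cases b with
    | true =>
      have hxi : x i = false := by simpa using Ne.symm h
      rw [weight_update_true hxi, succ_div_eq_of_mod_ne (mem_layerClass.1 hx).1]
    | false =>
      have hxi : x i = true := by simpa using Ne.symm h
      have hw := weight_update_true (x := Function.update x i false) (i := i) (by simp)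
      have hxx : Function.update (Function.update x i false) i true = x := by
        simp [← hxi]
      rw [hxx] at hw
      rw [hw, succ_div_eq_of_mod_ne (mem_layerClass.1 hy).1]

/-- The layers contain a cube in every set of at most `m` directions. -/
lemma card_lt_of_shatters_compl_layerClass {m : ℕ} (hn : m * (m + 2) + m + 1 ≤ n)
    {Y : Finset (Fin n)} (hY : Shatters (layerClass n m)ᶜ Y) : Y.card + m < n := by
  classical
  by_contra! hlt
  have hcompl : Yᶜ.card ≤ m := by
    rw [card_compl, Fintype.card_fin]; omega
  have hi : ∃ i ∈ Y, (i : ℕ) ≤ m := by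
    by_contra! h
    have hmn : m + 1 ≤ n := by omega
    have hsub : univ.map (Fin.castLEEmb hmn) ⊆ Yᶜ := by
      intro i hi
      obtain ⟨j, -, rfl⟩ := mem_map.1 hi
      exact mem_compl.2 fun hj => (h _ hj).not_ge (Nat.lt_succ_iff.1 j.2)
    have := card_le_card hsub
    rw [card_map, card_univ, Fintype.card_fin] at this
    omega
  obtain ⟨i, hiY, him⟩ := hi
  have hle : (i : ℕ) * (m + 2) ≤ (Y.erase i).card := by
    rw [card_erase_of_mem hiY]
    have : (i : ℕ) * (m + 2) ≤ m * (m + 2) := Nat.mul_le_mul_right _ him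
    omega
  obtain ⟨A, hA, hAcard⟩ := exists_subset_card_eq hle
  obtain ⟨c, hc, hcA⟩ := hY fun j => decide (j ∈ A)
  refine mem_compl.1 hc (mem_layerClass.2 ?_)
  have hci : c i = false := by
    rw [hcA i hiY]
    simpa using fun h => ne_of_mem_erase (hA h) rfl
  have hlow : A ⊆ univ.filter fun j => c j = true := fun j hj => by
    simp [hcA j (mem_of_mem_erase (hA hj)), hj]
  have hup : (univ.filter fun j => c j = true) ⊆ A ∪ Yᶜ := fun j hj => by
    by_cases hjY : j ∈ Y
    · have := (mem_filter.1 hj).2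
      rw [hcA j hjY] at this
      exact mem_union_left _ (by simpa using this)
    · exact mem_union_right _ (mem_compl.2 hjY)
  have h₁ : (i : ℕ) * (m + 2) ≤ weight c := hAcard ▸ card_le_card hlow
  have h₂ : weight c ≤ i * (m + 2) + m :=
    (card_le_card hup).trans ((card_union_le _ _).trans (by omega))
  obtain ⟨r, hr⟩ := Nat.exists_eq_add_of_le h₁
  have hrm : r < m + 2 := by omega
  rw [hr, mul_comm, Nat.mul_add_mod, Nat.mod_eq_of_lt hrm]
  refine ⟨by omega, i, ?_, hci⟩
  rw [Nat.mul_add_div (by omega), Nat.div_eq_of_lt hrm, add_zero]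

end Layers

/-- There is no constant `k` such that every finite maximal class of VC
dimension `d` embeds into a maximum class of VC dimension `d + k`: for every `k` there
exist `d`, `n` and a maximal class `C ⊆ {0,1}^n` of VC dimension `d` such that every
maximum class in `{0,1}^n` containing `C` has VC dimension exceeding `d + k`. -/
theorem stmt14 :
    ∀ k : ℕ, ∃ (d n : ℕ) (C : Finset (Fin n → Bool)),
      IsMaximalClass C d ∧
      ∀ (C' : Finset (Fin n → Bool)) (D : ℕ), C ⊆ C' → IsMaximum C' D → d + k < D := by
  intro k
  obtain ⟨n, hn⟩ : ∃ n, n = (k + 1) * (k + 1 + 2) + (k + 1) + 1 := ⟨_, rfl⟩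
  have hne : ((layerClass n (k + 1))ᶜ).Nonempty :=
    ⟨fun _ => true, by simp [mem_layerClass]⟩
  obtain ⟨d, M, hsub, hM, ⟨Y, rfl, hY⟩, -⟩ := exists_isMaximalClass_superset hne
  refine ⟨_, n, M, hM, fun C' D hMC hC' => ?_⟩
  have h₁ := card_lt_of_shatters_compl_layerClass hn.ge hY
  have h₂ := hC'.le_of_label (hsub.trans hMC) (fun x => weight x / (k + 1 + 2))
    (fun x i b hx hy => weight_div_update (by simpa using hx) (by simpa using hy))
    (fun x hx => (mem_layerClass.1 (by simpa using hx)).2)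
  omega

end GeomCompress
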